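/- Let n ≥ 1 be an integer and let B be a category admitting pullbacks and equalizers. Then the n-truncation functor sk_n : ΔB → Δ_n B, from simplicial objects of B to n-truncated simplicial objects of B, admits a right adjoint cosk_n (the n-coskeleton functor exists). -/

import Mathlib

open CategoryTheory CategoryTheory.Limits

namespace CategoryTheory.Limits

section FiniteConnected

variable {J : Type*} [Category J] {B : Type*} [Category B]

/-- An object `L` with projections to `F.obj j` for `j ∈ S` which are jointly monic and through
which every cone over `F` factors. It need not be compatible with the arrows of `J`. -/
structure WeakConeOn (F : J ⥤ B) (S : Set J) where
  pt : B
  π : ∀ j ∈ S, pt ⟶ F.obj j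
  hom_ext : ∀ {X : B} (g h : X ⟶ pt), (∀ j hj, g ≫ π j hj = h ≫ π j hj) → g = h
  exists_lift : ∀ c : Cone F, ∃ l : c.pt ⟶ pt, ∀ j hj, l ≫ π j hj = c.π.app j

namespace WeakConeOn

variable {F : J ⥤ B} {S : Set J}

/-- The weak cone on `{j}` given by `F.obj j`. -/
def singleton (F : J ⥤ B) (j : J) : WeakConeOn F {j} where
  pt := F.obj j
  π i hi := eqToHom (by rw [Set.mem_singleton_iff.1 hi])
  hom_ext g h H := by simpa using H j rfl
  exists_lift c := ⟨c.π.app j, by rintro i rfl; simp⟩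

open Classical in
/-- Change the vertex of a weak cone along `q : L ⟶ W.pt` and adjoin a projection at `a ∉ S`. -/
noncomputable def insertOf (W : WeakConeOn F S) {a : J} (ha : a ∉ S) {L : B} (q : L ⟶ W.pt)
    (p : L ⟶ F.obj a)
    (hom_ext : ∀ {X : B} (g h : X ⟶ L), g ≫ q = h ≫ q → g ≫ p = h ≫ p → g = h)
    (exists_lift : ∀ (c : Cone F) (l : c.pt ⟶ W.pt), (∀ j hj, l ≫ W.π j hj = c.π.app j) →
      ∃ l' : c.pt ⟶ L, l' ≫ q = l ∧ l' ≫ p = c.π.app a) :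
    WeakConeOn F (insert a S) where
  pt := L
  π j hj := if h : j ∈ S then q ≫ W.π j h else
    p ≫ eqToHom (by rw [hj.resolve_right h])
  hom_ext g h H := by
    refine hom_ext g h (W.hom_ext _ _ fun j hj => ?_) ?_
    · simpa [hj] using H j (Or.inr hj)
    · simpa [ha] using H a (Or.inl rfl)
  exists_lift c := by
    obtain ⟨l, hl⟩ := W.exists_lift c
    obtain ⟨l', h₁, h₂⟩ := exists_lift c l hl
    refine ⟨l', fun j hj => ?_⟩
    by_cases h : j ∈ S
    · rw [dif_pos h, ← Category.assoc, h₁, hl]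
    · obtain rfl : j = a := hj.resolve_right h
      simp [h, h₂]

/-- Extend a weak cone to the target of an arrow by composition. -/
noncomputable def insertTarget (W : WeakConeOn F S) {a b : J} (f : b ⟶ a) (hb : b ∈ S)
    (ha : a ∉ S) : WeakConeOn F (insert a S) :=
  W.insertOf ha (𝟙 _) (W.π b hb ≫ F.map f) (fun g h H _ => by simpa using H)
    fun c l hl => ⟨l, by simp, by
      rw [← Category.assoc, hl b hb, c.w f]⟩

/-- Extend a weak cone to the source of an arrow by a pullback. -/
noncomputable def insertSource [HasPullbacks B] (W : WeakConeOn F S) {a b : J} (f : a ⟶ b)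
    (hb : b ∈ S) (ha : a ∉ S) : WeakConeOn F (insert a S) :=
  W.insertOf ha (pullback.fst (W.π b hb) (F.map f)) (pullback.snd (W.π b hb) (F.map f))
    (fun _ _ H₁ H₂ => pullback.hom_ext H₁ H₂)
    fun c l hl => ⟨pullback.lift l (c.π.app a) ((hl b hb).trans (c.w f).symm),
      pullback.lift_fst _ _ _, pullback.lift_snd _ _ _⟩

/-- Force compatibility of a weak cone with a single arrow by an equalizer. -/
noncomputable def equalize [HasEqualizers B] (W : WeakConeOn F Set.univ) {a b : J} (f : a ⟶ b) :
    WeakConeOn F Set.univ where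
  pt := equalizer (W.π a trivial ≫ F.map f) (W.π b trivial)
  π j hj := equalizer.ι _ _ ≫ W.π j hj
  hom_ext g h H := equalizer.hom_ext (W.hom_ext _ _ fun j hj => by simpa using H j hj)
  exists_lift c := by
    obtain ⟨l, hl⟩ := W.exists_lift c
    exact ⟨equalizer.lift l (by
      rw [← Category.assoc, hl a trivial, hl b trivial, c.w f]),
      fun j hj => by simp [hl]⟩

lemma nonempty_univ [HasPullbacks B] [Finite J] [IsConnected J] (F : J ⥤ B) :
    Nonempty (WeakConeOn F Set.univ) := by
  obtain ⟨j₀⟩ := (inferInstance : Nonempty J)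
  obtain ⟨S, ⟨hS₀, ⟨W⟩⟩, hmax⟩ :=
    (Set.toFinite {S : Set J | j₀ ∈ S ∧ Nonempty (WeakConeOn F S)}).exists_maximal
      ⟨{j₀}, rfl, ⟨singleton F j₀⟩⟩
  have mem_of_insert {a : J} (h : a ∉ S → WeakConeOn F (insert a S)) : a ∈ S := by
    by_contra ha
    exact ha (hmax ⟨Or.inr hS₀, ⟨h ha⟩⟩ (Set.subset_insert a S) (Set.mem_insert a S))
  obtain rfl : S = Set.univ := Set.eq_univ_of_forall fun j =>
    induct_on_objects S hS₀ (fun f => ⟨fun h => mem_of_insert (W.insertTarget f h),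
      fun h => mem_of_insert (W.insertSource f h)⟩) j
  exact ⟨W⟩

lemma exists_compatible [HasEqualizers B] [Finite J] [∀ i j : J, Finite (i ⟶ j)]
    (W : WeakConeOn F Set.univ) :
    ∃ W' : WeakConeOn F Set.univ, ∀ {i j : J} (f : i ⟶ j),
      W'.π i trivial ≫ F.map f = W'.π j trivial := by
  have key (A : Set (Σ p : J × J, p.1 ⟶ p.2)) (hA : A.Finite) :
      ∃ W' : WeakConeOn F Set.univ, ∀ f ∈ A,
        W'.π f.1.1 trivial ≫ F.map f.2 = W'.π f.1.2 trivial := by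
    induction A, hA using Set.Finite.induction_on with
    | empty => exact ⟨W, by simp⟩
    | @insert f A _ _ ih =>
      obtain ⟨W', hW'⟩ := ih
      refine ⟨W'.equalize f.2, ?_⟩
      rintro g (rfl | hg)
      · simpa [equalize] using equalizer.condition _ _
      · simp [equalize, hW' g hg]
  obtain ⟨W', hW'⟩ := key Set.univ Set.finite_univ
  exact ⟨W', fun {i j} f => hW' ⟨(i, j), f⟩ trivial⟩

end WeakConeOn

/-- Pullbacks and equalizers suffice to construct all finite connected limits. -/
theorem hasLimitsOfShape_of_isConnected_of_hasPullbacks_of_hasEqualizers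
    [HasPullbacks B] [HasEqualizers B] [Finite J] [∀ i j : J, Finite (i ⟶ j)] [IsConnected J] :
    HasLimitsOfShape J B where
  has_limit F := by
    obtain ⟨W₀⟩ := WeakConeOn.nonempty_univ F
    obtain ⟨W, hW⟩ := W₀.exists_compatible
    choose l hl using W.exists_lift
    exact ⟨⟨⟨⟨W.pt, { app := fun j => W.π j trivial, naturality := by simp [hW] }⟩,
      { lift := l
        fac := fun c j => hl c j trivial
        uniq := fun c m hm => W.hom_ext _ _ fun j _ => (hm j).trans (hl c j trivial).symm }⟩⟩⟩

end FiniteConnected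

end CategoryTheory.Limits

namespace SimplexCategory

instance finite_hom (X Y : SimplexCategory) : Finite (X ⟶ Y) :=
  Finite.of_injective (fun f => (f.toOrderHom : Fin (X.len + 1) → Fin (Y.len + 1)))
    fun f g h => SimplexCategory.Hom.ext f g (DFunLike.coe_injective h)

namespace Truncated

instance finite (n : ℕ) : Finite (Truncated n) :=
  Finite.of_injective (fun X => (⟨X.obj.len, Nat.lt_succ_of_le X.property⟩ : Fin (n + 1)))
    fun _ _ h => ObjectProperty.FullSubcategory.ext
      (SimplexCategory.ext (congrArg Fin.val h))

instance finite_hom {n : ℕ} (X Y : Truncated n) : Finite (X ⟶ Y) :=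
  Finite.of_injective (fun f => f.hom) fun _ _ h => ObjectProperty.hom_ext _ h

end Truncated

end SimplexCategory

namespace CategoryTheory

instance finite_hom_op {C : Type*} [Category C] [∀ X Y : C, Finite (X ⟶ Y)] (X Y : Cᵒᵖ) :
    Finite (X ⟶ Y) :=
  Finite.of_equiv _ (opEquiv X Y).symm

namespace StructuredArrow

variable {C D : Type*} [Category C] [Category D] (d : D) (F : C ⥤ D)

instance finite [Finite C] [∀ X : C, Finite (d ⟶ F.obj X)] : Finite (StructuredArrow d F) :=
  Finite.of_surjective (fun p : Σ X : C, d ⟶ F.obj X => mk p.2)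
    fun f => ⟨⟨f.right, f.hom⟩, f.eq_mk.symm⟩

instance finite_hom [∀ X Y : C, Finite (X ⟶ Y)] (f g : StructuredArrow d F) : Finite (f ⟶ g) :=
  Finite.of_injective (fun u => u.right) fun u v h => hom_ext u v h

end StructuredArrow

end CategoryTheory

/-- If `n ≥ 1` and `B` admits pullbacks and equalizers, then the `n`-truncation functor
`sk_n : ΔB → Δ_n B` from simplicial objects to `n`-truncated simplicial objects admits a
right adjoint (the `n`-coskeleton exists). -/
theorem truncation_isLeftAdjoint (n : ℕ) (hn : 1 ≤ n) (B : Type*) [Category B]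
    [HasPullbacks B] [HasEqualizers B] :
    (SimplicialObject.truncation (C := B) n).IsLeftAdjoint := by
  have : NeZero n := ⟨by omega⟩
  have (d : SimplexCategoryᵒᵖ) :
      IsConnected (StructuredArrow d (SimplexCategory.Truncated.inclusion n).op) :=
    Functor.Final.out d
  have (d : SimplexCategoryᵒᵖ) :
      HasLimitsOfShape (StructuredArrow d (SimplexCategory.Truncated.inclusion n).op) B :=
    have : Finite (SimplexCategory.Truncated n)ᵒᵖ := Finite.of_equiv _ Opposite.equivToOpposite
    hasLimitsOfShape_of_isConnected_of_hasPullbacks_of_hasEqualizers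
  have (F : (SimplexCategory.Truncated n)ᵒᵖ ⥤ B) :
      (SimplexCategory.Truncated.inclusion n).op.HasPointwiseRightKanExtension F :=
    fun d => inferInstanceAs (HasLimit _)
  exact (SimplicialObject.coskAdj n).isLeftAdjoint
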